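/- Assume DᵀD ≻ 0 and that there exists a symmetric matrix L ⪰ 0 with L = Ric^α(L). Define the Riccati iterates Q₀ = 0 and Q_{k+1} = Ric^α(Q_k). Then the sequence (Q_k) is well defined, monotone nondecreasing in the Loewner order, and bounded above by L: 0 ⪯ Q_k ⪯ Q_{k+1} ⪯ L for every k ≥ 0. -/

import Mathlib

open Matrix

noncomputable section

/-- `Z_x(U) = Diag(σ̄ₓᵀ U σ̄ₓ)`. -/
def Zx {n : ℕ} (σbx U : Matrix (Fin n) (Fin n) ℝ) : Matrix (Fin n) (Fin n) ℝ :=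
  Matrix.diagonal (fun i => (σbxᵀ * U * σbx) i i)

/-- `Z_u(U) = Diag(σ̄ᵤᵀ U σ̄ᵤ)`. -/
def Zu {n m : ℕ} (σbu : Matrix (Fin n) (Fin m) ℝ) (U : Matrix (Fin n) (Fin n) ℝ) :
    Matrix (Fin m) (Fin m) ℝ :=
  Matrix.diagonal (fun i => (σbuᵀ * U * σbu) i i)

/-- `L^α(U) = α (Aᵀ U A + Z_x(U))`. -/
def Lop {n : ℕ} (α : ℝ) (A σbx U : Matrix (Fin n) (Fin n) ℝ) : Matrix (Fin n) (Fin n) ℝ :=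
  α • (Aᵀ * U * A + Zx σbx U)

/-- `Σ(U) = Bᵀ U A + α⁻¹ Dᵀ C`. -/
def Sig {n m p : ℕ} (α : ℝ) (A : Matrix (Fin n) (Fin n) ℝ) (B : Matrix (Fin n) (Fin m) ℝ)
    (C : Matrix (Fin p) (Fin n) ℝ) (D : Matrix (Fin p) (Fin m) ℝ)
    (U : Matrix (Fin n) (Fin n) ℝ) : Matrix (Fin m) (Fin n) ℝ :=
  Bᵀ * U * A + α⁻¹ • (Dᵀ * C)

/-- `Λ(U) = Bᵀ U B + Z_u(U) + α⁻¹ Dᵀ D`. -/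
def Lam {n m p : ℕ} (α : ℝ) (B σbu : Matrix (Fin n) (Fin m) ℝ) (D : Matrix (Fin p) (Fin m) ℝ)
    (U : Matrix (Fin n) (Fin n) ℝ) : Matrix (Fin m) (Fin m) ℝ :=
  Bᵀ * U * B + Zu σbu U + α⁻¹ • (Dᵀ * D)

/-- `Ric^α(U) = L^α(U) − α Σ(U)ᵀ Λ(U)⁻¹ Σ(U) + Cᵀ C`. -/
def Ric {n m p : ℕ} (α : ℝ) (A σbx : Matrix (Fin n) (Fin n) ℝ) (B σbu : Matrix (Fin n) (Fin m) ℝ)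
    (C : Matrix (Fin p) (Fin n) ℝ) (D : Matrix (Fin p) (Fin m) ℝ)
    (U : Matrix (Fin n) (Fin n) ℝ) : Matrix (Fin n) (Fin n) ℝ :=
  Lop α A σbx U - α • ((Sig α A B C D U)ᵀ * (Lam α B σbu D U)⁻¹ * Sig α A B C D U) + Cᵀ * C

/-- `H^α_G(U) = L^α(U) + Cᵀ C + α (Gᵀ Λ(U) G + Σ(U)ᵀ G + Gᵀ Σ(U))`. -/
def HG {n m p : ℕ} (α : ℝ) (A σbx : Matrix (Fin n) (Fin n) ℝ) (B σbu : Matrix (Fin n) (Fin m) ℝ)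
    (C : Matrix (Fin p) (Fin n) ℝ) (D : Matrix (Fin p) (Fin m) ℝ)
    (G : Matrix (Fin m) (Fin n) ℝ) (U : Matrix (Fin n) (Fin n) ℝ) : Matrix (Fin n) (Fin n) ℝ :=
  Lop α A σbx U + Cᵀ * C +
    α • (Gᵀ * Lam α B σbu D U * G + (Sig α A B C D U)ᵀ * G + Gᵀ * Sig α A B C D U)

end

section RiccatiComparison

variable {n m p : ℕ} {α : ℝ} {A σbx : Matrix (Fin n) (Fin n) ℝ} {B σbu : Matrix (Fin n) (Fin m) ℝ}
  {C : Matrix (Fin p) (Fin n) ℝ} {D : Matrix (Fin p) (Fin m) ℝ} {U W : Matrix (Fin n) (Fin n) ℝ}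

lemma Matrix.PosSemidef.transpose_mul_mul_same {k l : Type*} [Fintype k] [Fintype l]
    {M : Matrix k k ℝ} (hM : M.PosSemidef) (N : Matrix k l ℝ) : (Nᵀ * M * N).PosSemidef := by
  simpa only [conjTranspose_eq_transpose_of_trivial] using hM.conjTranspose_mul_mul_same N

lemma Zu_posSemidef (σbu : Matrix (Fin n) (Fin m) ℝ) (hU : U.PosSemidef) :
    (Zu σbu U).PosSemidef :=
  PosSemidef.diagonal fun _ => (hU.transpose_mul_mul_same σbu).diag_nonneg

lemma Zx_posSemidef (σbx : Matrix (Fin n) (Fin n) ℝ) (hU : U.PosSemidef) :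
    (Zx σbx U).PosSemidef :=
  Zu_posSemidef σbx hU

lemma Zu_sub (σbu : Matrix (Fin n) (Fin m) ℝ) (W U : Matrix (Fin n) (Fin n) ℝ) :
    Zu σbu (W - U) = Zu σbu W - Zu σbu U := by
  simp [Zu, Matrix.mul_sub, Matrix.sub_mul, diagonal_sub]

lemma Zx_sub (σbx W U : Matrix (Fin n) (Fin n) ℝ) :
    Zx σbx (W - U) = Zx σbx W - Zx σbx U :=
  Zu_sub σbx W U

lemma Lam_posDef (hα : 0 < α) (hD : (Dᵀ * D).PosDef) (hU : U.PosSemidef) :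
    (Lam α B σbu D U).PosDef :=
  PosDef.posSemidef_add ((hU.transpose_mul_mul_same B).add (Zu_posSemidef σbu hU))
    (hD.smul (inv_pos.mpr hα))

/-- Completing the square in the gain `G`. -/
lemma HG_eq_Ric_add (hΛ : (Lam α B σbu D U).PosDef) (G : Matrix (Fin m) (Fin n) ℝ) :
    HG α A σbx B σbu C D G U = Ric α A σbx B σbu C D U +
      α • ((G + (Lam α B σbu D U)⁻¹ * Sig α A B C D U)ᵀ * Lam α B σbu D U *
        (G + (Lam α B σbu D U)⁻¹ * Sig α A B C D U)) := by
  have hdet : IsUnit (Lam α B σbu D U).det := (isUnit_iff_isUnit_det _).mp hΛ.isUnit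
  have hsymm : (Lam α B σbu D U)ᵀ = Lam α B σbu D U := by
    simpa only [conjTranspose_eq_transpose_of_trivial] using hΛ.isHermitian.eq
  unfold HG Ric
  generalize Lam α B σbu D U = Λ at *
  simp only [transpose_add, transpose_mul, transpose_nonsing_inv, hsymm, Matrix.add_mul,
    Matrix.mul_add, Matrix.mul_assoc, mul_nonsing_inv_cancel_left _ _ hdet,
    nonsing_inv_mul_cancel_left _ _ hdet]
  module

lemma HG_sub_Ric_posSemidef (hα : 0 < α) (hΛ : (Lam α B σbu D U).PosDef)
    (G : Matrix (Fin m) (Fin n) ℝ) :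
    (HG α A σbx B σbu C D G U - Ric α A σbx B σbu C D U).PosSemidef := by
  rw [HG_eq_Ric_add hΛ, add_sub_cancel_left]
  exact (hΛ.posSemidef.transpose_mul_mul_same _).smul hα.le

lemma Ric_eq_HG (hΛ : (Lam α B σbu D U).PosDef) :
    Ric α A σbx B σbu C D U =
      HG α A σbx B σbu C D (-((Lam α B σbu D U)⁻¹ * Sig α A B C D U)) U := by
  simp [HG_eq_Ric_add hΛ]

lemma HG_sub_HG (hU : Uᵀ = U) (hW : Wᵀ = W) (G : Matrix (Fin m) (Fin n) ℝ) :
    HG α A σbx B σbu C D G W - HG α A σbx B σbu C D G U =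
      α • ((A + B * G)ᵀ * (W - U) * (A + B * G) + Zx σbx (W - U) +
        Gᵀ * Zu σbu (W - U) * G) := by
  simp only [HG, Lop, Lam, Sig, Zx_sub, Zu_sub, transpose_add, transpose_mul, transpose_smul,
    transpose_transpose, hU, hW, Matrix.add_mul, Matrix.mul_add, Matrix.sub_mul, Matrix.mul_sub,
    Matrix.mul_assoc, Matrix.smul_mul, Matrix.mul_smul]
  module

lemma HG_sub_HG_posSemidef (hα : 0 < α) (hU : U.PosSemidef) (hW : W.PosSemidef)
    (hUW : (W - U).PosSemidef) (G : Matrix (Fin m) (Fin n) ℝ) :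
    (HG α A σbx B σbu C D G W - HG α A σbx B σbu C D G U).PosSemidef := by
  have hU' := hU.isHermitian.eq
  have hW' := hW.isHermitian.eq
  rw [conjTranspose_eq_transpose_of_trivial] at hU' hW'
  rw [HG_sub_HG hU' hW']
  exact (((hUW.transpose_mul_mul_same _).add (Zx_posSemidef σbx hUW)).add
    ((Zu_posSemidef σbu hUW).transpose_mul_mul_same G)).smul hα.le

lemma Ric_sub_Ric_posSemidef (hα : 0 < α) (hD : (Dᵀ * D).PosDef) (hU : U.PosSemidef)
    (hW : W.PosSemidef) (hUW : (W - U).PosSemidef) :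
    (Ric α A σbx B σbu C D W - Ric α A σbx B σbu C D U).PosSemidef := by
  rw [Ric_eq_HG (Lam_posDef hα hD hW), ← sub_add_sub_cancel _ (HG α A σbx B σbu C D _ U)]
  exact (HG_sub_HG_posSemidef hα hU hW hUW _).add
    (HG_sub_Ric_posSemidef hα (Lam_posDef hα hD hU) _)

lemma HG_zero (hα : 0 < α) (G : Matrix (Fin m) (Fin n) ℝ) :
    HG α A σbx B σbu C D G 0 = (C + D * G)ᵀ * (C + D * G) := by
  simp only [HG, Lop, Lam, Sig, Zx, Zu, Matrix.mul_zero, Matrix.zero_mul, Matrix.zero_apply,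
    diagonal_zero, zero_add, smul_zero, transpose_add, transpose_mul, transpose_smul,
    transpose_transpose, Matrix.add_mul, Matrix.mul_add, Matrix.mul_assoc, Matrix.smul_mul,
    Matrix.mul_smul, smul_add, smul_inv_smul₀ hα.ne']
  abel

lemma Ric_zero_posSemidef (hα : 0 < α) (hD : (Dᵀ * D).PosDef) :
    (Ric α A σbx B σbu C D 0).PosSemidef := by
  rw [Ric_eq_HG (Lam_posDef hα hD .zero), HG_zero hα]
  rw [← conjTranspose_eq_transpose_of_trivial]
  exact posSemidef_conjTranspose_mul_self _

end RiccatiComparison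

/-- If `DᵀD ≻ 0` and a symmetric `L ⪰ 0` satisfies `L = Ric^α(L)`, then the
Riccati iterates `Q₀ = 0`, `Q_{k+1} = Ric^α(Q_k)` are well defined (each `Λ(Q_k) ≻ 0`),
monotone nondecreasing in the Loewner order, and bounded above by `L`:
`0 ⪯ Q_k ⪯ Q_{k+1} ⪯ L` for every `k`. -/
theorem stmt18 {n m p : ℕ} (α : ℝ) (hα : 0 < α) (A σbx : Matrix (Fin n) (Fin n) ℝ)
    (B σbu : Matrix (Fin n) (Fin m) ℝ) (C : Matrix (Fin p) (Fin n) ℝ)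
    (D : Matrix (Fin p) (Fin m) ℝ) (hD : (Dᵀ * D).PosDef)
    (L : Matrix (Fin n) (Fin n) ℝ) (hL : L.PosSemidef) (hfix : L = Ric α A σbx B σbu C D L)
    (Q : ℕ → Matrix (Fin n) (Fin n) ℝ) (hQ0 : Q 0 = 0)
    (hQsucc : ∀ k, Q (k + 1) = Ric α A σbx B σbu C D (Q k)) :
    ∀ k, (Lam α B σbu D (Q k)).PosDef ∧ (Q k).PosSemidef ∧
      (Q (k + 1) - Q k).PosSemidef ∧ (L - Q k).PosSemidef := by
  have key : ∀ k, (Q k).PosSemidef ∧ (Q (k + 1) - Q k).PosSemidef ∧ (L - Q k).PosSemidef := by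
    intro k
    induction k with
    | zero =>
      rw [hQsucc, hQ0, sub_zero, sub_zero]
      exact ⟨.zero, Ric_zero_posSemidef hα hD, hL⟩
    | succ k ih =>
      obtain ⟨hk, hstep, hkL⟩ := ih
      have hk1 : (Q (k + 1)).PosSemidef := by simpa using hk.add hstep
      refine ⟨hk1, ?_, ?_⟩
      · have h := Ric_sub_Ric_posSemidef (A := A) (σbx := σbx) (B := B) (σbu := σbu) (C := C)
          hα hD hk hk1 hstep
        rwa [← hQsucc, ← hQsucc] at h
      · have h := Ric_sub_Ric_posSemidef (A := A) (σbx := σbx) (B := B) (σbu := σbu) (C := C)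
          hα hD hk hL hkL
        rwa [← hQsucc, ← hfix] at h
  exact fun k => ⟨Lam_posDef hα hD (key k).1, key k⟩
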